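/- The second adjoint cohomology of the 2nd Schrödinger algebra sch_2 is one-dimensional: dim H²(sch_2, sch_2) = 1. -/

import Mathlib

open scoped BigOperators

/-- Basis index set for the `n`-th Schrödinger algebra
`sch_n = span {h, e, f, x_1, …, x_n, y_1, …, y_n, z}`. -/
inductive SchIdx (n : ℕ) : Type
  | H : SchIdx n
  | E : SchIdx n
  | F : SchIdx n
  | X : Fin n → SchIdx n
  | Y : Fin n → SchIdx n
  | Z : SchIdx n
  deriving DecidableEq

/-- The underlying vector space of the `n`-th Schrödinger algebra. -/
abbrev Sch (n : ℕ) : Type := SchIdx n → ℂ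

/-- The Lie bracket of `sch_n`, written componentwise with respect to the basis;
it encodes exactly the relations `[e,f]=h, [h,e]=2e, [h,f]=-2f, [x_i,y_i]=z,
[h,x_i]=x_i, [h,y_i]=-y_i, [e,y_i]=x_i, [f,x_i]=y_i`. -/
noncomputable def br {n : ℕ} (u v : Sch n) : Sch n := fun j =>
  match j with
  | .H => u .E * v .F - u .F * v .E
  | .E => 2 * (u .H * v .E - u .E * v .H)
  | .F => -2 * (u .H * v .F - u .F * v .H)
  | .X i => (u .H * v (.X i) - u (.X i) * v .H) + (u .E * v (.Y i) - u (.Y i) * v .E)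
  | .Y i => -(u .H * v (.Y i) - u (.Y i) * v .H) + (u .F * v (.X i) - u (.X i) * v .F)
  | .Z => ∑ i : Fin n, (u (.X i) * v (.Y i) - u (.Y i) * v (.X i))

/-- The bracket of `sch_n` as a bilinear map. -/
noncomputable def brL (n : ℕ) : Sch n →ₗ[ℂ] Sch n →ₗ[ℂ] Sch n :=
  LinearMap.mk₂ ℂ br
    (by
      intro m m' v; funext j; cases j <;> simp only [br, Pi.add_apply]
      case Z => rw [← Finset.sum_add_distrib]; exact Finset.sum_congr rfl fun i _ => by ring
      all_goals ring)
    (by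
      intro c m v; funext j; cases j <;> simp only [br, Pi.smul_apply, smul_eq_mul]
      case Z => rw [Finset.mul_sum]; exact Finset.sum_congr rfl fun i _ => by ring
      all_goals ring)
    (by
      intro m v v'; funext j; cases j <;> simp only [br, Pi.add_apply]
      case Z => rw [← Finset.sum_add_distrib]; exact Finset.sum_congr rfl fun i _ => by ring
      all_goals ring)
    (by
      intro c m v; funext j; cases j <;> simp only [br, Pi.smul_apply, smul_eq_mul]
      case Z => rw [Finset.mul_sum]; exact Finset.sum_congr rfl fun i _ => by ring
      all_goals ring)

/-- The basis vector `h`. -/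
noncomputable def hV (n : ℕ) : Sch n := Pi.single SchIdx.H 1
/-- The basis vector `e`. -/
noncomputable def eV (n : ℕ) : Sch n := Pi.single SchIdx.E 1
/-- The basis vector `f`. -/
noncomputable def fV (n : ℕ) : Sch n := Pi.single SchIdx.F 1
/-- The central basis vector `z`. -/
noncomputable def zV (n : ℕ) : Sch n := Pi.single SchIdx.Z 1
/-- The basis vector `x_i`. -/
noncomputable def xV {n : ℕ} (i : Fin n) : Sch n := Pi.single (SchIdx.X i) 1
/-- The basis vector `y_i`. -/
noncomputable def yV {n : ℕ} (i : Fin n) : Sch n := Pi.single (SchIdx.Y i) 1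

/-- The subalgebra `sl_2 = span {e, f, h}` of `sch_n`. -/
noncomputable def sl2 (n : ℕ) : Submodule ℂ (Sch n) :=
  Submodule.span ℂ {eV n, fV n, hV n}
noncomputable instance (n : ℕ) : AddCommGroup (Sch n →ₗ[ℂ] Sch n →ₗ[ℂ] Sch n) :=
  LinearMap.addCommGroup

noncomputable instance (n : ℕ) : Module ℂ (Sch n →ₗ[ℂ] Sch n →ₗ[ℂ] Sch n) :=
  LinearMap.module

/-- The space `Z²(sch_n, sch_n)` of 2-cocycles with values in the adjoint module:
alternating bilinear maps `φ : sch_n × sch_n → sch_n` satisfying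
`[x,φ(y,z)] + [y,φ(z,x)] + [z,φ(x,y)] + φ(x,[y,z]) + φ(y,[z,x]) + φ(z,[x,y]) = 0`. -/
noncomputable def adjZ2 (n : ℕ) : Submodule ℂ (Sch n →ₗ[ℂ] Sch n →ₗ[ℂ] Sch n) where
  carrier := {φ | (∀ a, φ a a = 0) ∧
    ∀ a b c, brL n a (φ b c) + brL n b (φ c a) + brL n c (φ a b) +
      φ a (brL n b c) + φ b (brL n c a) + φ c (brL n a b) = 0}
  add_mem' := by
    rintro φ ψ ⟨hφ1, hφ2⟩ ⟨hψ1, hψ2⟩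
    refine ⟨fun a => ?_, fun a b c => ?_⟩
    · simp only [LinearMap.add_apply, hφ1 a, hψ1 a, add_zero]
    · simp only [LinearMap.add_apply, map_add]
      linear_combination hφ2 a b c + hψ2 a b c
  zero_mem' := ⟨fun a => rfl, fun a b c => by simp⟩
  smul_mem' := by
    rintro c φ ⟨hφ1, hφ2⟩
    refine ⟨fun a => ?_, fun a b c' => ?_⟩
    · simp only [LinearMap.smul_apply, hφ1 a, smul_zero]
    · simp only [LinearMap.smul_apply, map_smul]
      simp only [← smul_add]
      rw [hφ2 a b c', smul_zero]

/-- The space `B²(sch_n, sch_n)` of 2-coboundaries with values in the adjoint module: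
maps of the form `φ(x,y) = [ω(x),y] + [x,ω(y)] - ω([x,y])` for a linear `ω : sch_n → sch_n`. -/
noncomputable def adjB2 (n : ℕ) : Submodule ℂ (Sch n →ₗ[ℂ] Sch n →ₗ[ℂ] Sch n) where
  carrier := {φ | ∃ ω : Sch n →ₗ[ℂ] Sch n, ∀ a b,
    φ a b = brL n (ω a) b + brL n a (ω b) - ω (brL n a b)}
  add_mem' := by
    rintro φ ψ ⟨ω, hω⟩ ⟨σ, hσ⟩
    refine ⟨ω + σ, fun a b => ?_⟩
    simp only [LinearMap.add_apply, map_add, hω a b, hσ a b]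
    abel
  zero_mem' := ⟨0, fun a b => by simp⟩
  smul_mem' := by
    rintro c φ ⟨ω, hω⟩
    refine ⟨c • ω, fun a b => ?_⟩
    simp only [LinearMap.smul_apply, map_smul, hω a b, smul_add, smul_sub]

noncomputable instance (n : ℕ) :
    HasQuotient (↥(adjZ2 n)) (Submodule ℂ ↥(adjZ2 n)) :=
  Submodule.hasQuotient

namespace SchIdx

instance (n : ℕ) : Fintype (SchIdx n) where
  elems := {H, E, F, Z} ∪ (Finset.univ.image X ∪ Finset.univ.image Y)
  complete i := by cases i <;> simp

theorem sum_two {M : Type*} [AddCommMonoid M] (g : SchIdx 2 → M) :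
    ∑ i, g i = g H + g E + g F + g Z + g (X 0) + g (X 1) + g (Y 0) + g (Y 1) := by
  have : (Finset.univ : Finset (SchIdx 2)) = {H, E, F, Z, X 0, X 1, Y 0, Y 1} := by decide
  rw [this]
  simp [Finset.sum_insert]
  abel

/-- The eigenvalue of `ad h` on a basis vector. -/
def wt {n : ℕ} : SchIdx n → ℂ
  | H => 0
  | E => 2
  | F => -2
  | X _ => 1
  | Y _ => -1
  | Z => 0

end SchIdx

open SchIdx

/-- The basis vectors of `sch_n`. -/
noncomputable abbrev bV {n : ℕ} (i : SchIdx n) : Sch n := Pi.single i 1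

theorem Sch.map_eq_sum {n : ℕ} {M : Type*} [AddCommGroup M] [Module ℂ M]
    (g : Sch n →ₗ[ℂ] M) (u : Sch n) : g u = ∑ i, u i • g (bV i) := by
  conv_lhs => rw [pi_eq_sum_univ' u]
  simp only [map_sum, map_smul]

@[simp]
theorem brL_apply {n : ℕ} (u v : Sch n) : brL n u v = br u v := rfl

theorem br_self {n : ℕ} (u : Sch n) : br u u = 0 := by
  funext j
  cases j <;> simp [br, mul_comm]

theorem br_swap {n : ℕ} (u v : Sch n) : br u v = -br v u := by
  funext j
  cases j <;> simp only [br, Pi.neg_apply, ← Finset.sum_neg_distrib]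
  case Z => exact Finset.sum_congr rfl fun i _ => by ring
  all_goals ring

theorem br_jacobi {n : ℕ} (u v w : Sch n) :
    br u (br v w) + br v (br w u) + br w (br u v) = 0 := by
  funext j
  cases j <;> simp only [br, Pi.add_apply, Pi.zero_apply, ← Finset.sum_add_distrib]
  case Z => exact Finset.sum_eq_zero fun i _ => by ring
  all_goals ring

/-- The coboundary of a linear endomorphism. -/
noncomputable def cob {n : ℕ} (ω : Sch n →ₗ[ℂ] Sch n) : Sch n →ₗ[ℂ] Sch n →ₗ[ℂ] Sch n :=
  brL n ∘ₗ ω + (brL n).compl₂ ω - (brL n).compr₂ ω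

@[simp]
theorem cob_apply {n : ℕ} (ω : Sch n →ₗ[ℂ] Sch n) (a b : Sch n) :
    cob ω a b = br (ω a) b + br a (ω b) - ω (br a b) := rfl

theorem cob_mem_adjB2 {n : ℕ} (ω : Sch n →ₗ[ℂ] Sch n) : cob ω ∈ adjB2 n :=
  ⟨ω, fun _ _ => rfl⟩

theorem adjB2_le_adjZ2 (n : ℕ) : adjB2 n ≤ adjZ2 n := by
  rintro φ ⟨ω, hω⟩
  refine ⟨fun a => ?_, fun a b c => ?_⟩
  · rw [hω, brL_apply, brL_apply, brL_apply, br_self, br_swap a, map_zero]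
    abel
  · have h₁ := br_jacobi (ω a) b c
    have h₂ := br_jacobi a (ω b) c
    have h₃ := br_jacobi a b (ω c)
    have h₄ := congrArg ω (br_jacobi a b c)
    simp only [map_add, map_zero] at h₄
    simp only [hω, map_add, map_sub]
    simp only [brL_apply]
    linear_combination h₁ + h₂ + h₃ - h₄

theorem br_bV_apply_of_wt {n : ℕ} {i k : SchIdx n} {u v : Sch n} (c : ℂ)
    (h : ∀ l, wt l + wt i = wt k → u l = c * v l) : br (bV i) u k = c * br (bV i) v k := by
  have hZ := h Z
  have hH := h H
  have hE := h E
  have hF := h F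
  have hX := fun l => h (X l)
  have hY := fun l => h (Y l)
  cases i <;> cases k <;> norm_num [br, wt, Pi.single_apply] at * <;> simp_all <;> ring

theorem br_bV_bV_apply_of_wt {n : ℕ} {i j k : SchIdx n} (h : wt k ≠ wt i + wt j) :
    br (bV i) (bV j) k = 0 := by
  have := br_bV_apply_of_wt (i := i) (k := k) (u := bV j) (v := 0) 0 fun l hl => by
    rw [zero_mul]
    exact Pi.single_eq_of_ne (by rintro rfl; exact h (by rw [← hl, add_comm])) _
  simpa using this

theorem br_hV_apply {n : ℕ} (u : Sch n) (k : SchIdx n) : br (bV H) u k = wt k * u k := by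
  cases k <;> simp [br, wt]

theorem br_bV_hV {n : ℕ} (i : SchIdx n) : br (bV H) (bV i) = wt i • bV i := by
  funext k
  rw [br_hV_apply, Pi.smul_apply, smul_eq_mul]
  by_cases h : k = i
  · rw [h]
  · simp [h]

theorem adjZ2_swap {n : ℕ} {φ : Sch n →ₗ[ℂ] Sch n →ₗ[ℂ] Sch n} (hφ : φ ∈ adjZ2 n)
    (a b : Sch n) : φ b a = -φ a b := by
  have h := hφ.1 (a + b)
  simp only [map_add, LinearMap.add_apply, hφ.1 a, hφ.1 b, zero_add, add_zero] at h
  exact eq_neg_of_add_eq_zero_left h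

/-- Every cocycle is cohomologous to one that preserves weights. -/
theorem exists_cob_wt {n : ℕ} {φ : Sch n →ₗ[ℂ] Sch n →ₗ[ℂ] Sch n} (hφ : φ ∈ adjZ2 n) :
    ∃ ω : Sch n →ₗ[ℂ] Sch n, ∀ i j k, wt k ≠ wt i + wt j →
      φ (bV i) (bV j) k = cob ω (bV i) (bV j) k := by
  let ω : Sch n →ₗ[ℂ] Sch n := Fintype.linearCombination ℂ
    fun i k => (wt k - wt i)⁻¹ * φ (bV H) (bV i) k
  have hω (i k) : ω (bV i) k = (wt k - wt i)⁻¹ * φ (bV H) (bV i) k := by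
    simp [ω, Fintype.linearCombination_apply_single]
  have hbr {i j k : SchIdx n} :
      br (bV i) (ω (bV j)) k = (wt k - wt i - wt j)⁻¹ * br (bV i) (φ (bV H) (bV j)) k :=
    br_bV_apply_of_wt _ fun l hl => by rw [hω, ← hl, add_sub_cancel_right]
  refine ⟨ω, fun i j k hk => ?_⟩
  have hωbr : ω (br (bV i) (bV j)) k =
      (wt k - wt i - wt j)⁻¹ * φ (bV H) (br (bV i) (bV j)) k := by
    rw [Sch.map_eq_sum ω, Sch.map_eq_sum (φ (bV H)), Finset.sum_apply, Finset.sum_apply,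
      Finset.mul_sum]
    refine Finset.sum_congr rfl fun l _ => ?_
    simp only [Pi.smul_apply, smul_eq_mul, hω]
    by_cases hl : wt l = wt i + wt j
    · rw [hl, sub_sub]
      ring
    · rw [br_bV_bV_apply_of_wt hl]
      ring
  have hd : wt k - wt i - wt j ≠ 0 := by rwa [sub_sub, sub_ne_zero]
  have key := congrFun (hφ.2 (bV H) (bV i) (bV j)) k
  simp only [brL_apply, br_swap (bV j) (bV H), br_bV_hV, map_neg, map_smul, Pi.add_apply,
    Pi.neg_apply, Pi.smul_apply, smul_eq_mul, br_hV_apply, Pi.zero_apply,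
    adjZ2_swap hφ (bV H) (bV j), adjZ2_swap hφ (bV i) (bV j)] at key
  rw [cob_apply, Pi.sub_apply, Pi.add_apply, br_swap (ω _), Pi.neg_apply, hbr, hbr, hωbr,
    sub_right_comm (wt k) (wt j)]
  field_simp
  linear_combination key

theorem adjZ2_coord {n : ℕ} {φ : Sch n →ₗ[ℂ] Sch n →ₗ[ℂ] Sch n} (hφ : φ ∈ adjZ2 n)
    (i j k l : SchIdx n) :
    br (bV i) (φ (bV j) (bV k)) l + br (bV j) (φ (bV k) (bV i)) l +
      br (bV k) (φ (bV i) (bV j)) l + ∑ m, br (bV j) (bV k) m * φ (bV i) (bV m) l +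
      ∑ m, br (bV k) (bV i) m * φ (bV j) (bV m) l +
      ∑ m, br (bV i) (bV j) m * φ (bV k) (bV m) l = 0 := by
  have h := congrFun (hφ.2 (bV i) (bV j) (bV k)) l
  simp only [brL_apply] at h
  rw [Sch.map_eq_sum (φ (bV i)) (br _ _), Sch.map_eq_sum (φ (bV j)) (br _ _),
    Sch.map_eq_sum (φ (bV k)) (br _ _)] at h
  simpa using h

set_option maxHeartbeats 1000000 in
/-- A weight-preserving cocycle of `sch_2` with enough vanishing coordinates is zero. -/
theorem eq_zero_of_coords {ψ : Sch 2 →ₗ[ℂ] Sch 2 →ₗ[ℂ] Sch 2} (hψ : ψ ∈ adjZ2 2)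
    (hwt : ∀ i j k, wt k ≠ wt i + wt j → ψ (bV i) (bV j) k = 0)
    (h_he : ψ (bV H) (bV E) E = 0) (h_efh : ψ (bV E) (bV F) H = 0)
    (h_efz : ψ (bV E) (bV F) Z = 0) (h_ez : ψ (bV E) (bV Z) E = 0)
    (h_fx : ∀ i j, ψ (bV F) (bV (X i)) (Y j) = 0)
    (h_xyz : ∀ i j, i ≤ j → ψ (bV (X i)) (bV (Y j)) Z = 0)
    (h_xx : ψ (bV (X 0)) (bV (X 1)) E = 0) : ψ = 0 := by
  have hswap (i j k) : ψ (bV j) (bV i) k = -ψ (bV i) (bV j) k := by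
    rw [adjZ2_swap hψ (bV i) (bV j), Pi.neg_apply]
  have hdiag (i k) : ψ (bV i) (bV i) k = 0 := congrFun (hψ.1 _) k
  have hx := hswap (X 0) (X 1)
  have hy := hswap (Y 0) (Y 1)
  have co (i j k l) := adjZ2_coord hψ i j k l
  simp only [sum_two] at co
  have c_hefH := co H E F H
  have c_heyX (i j : Fin 2) := co H E (Y i) (X j)
  have c_hxyZ (i j : Fin 2) := co H (X i) (Y j) Z
  have c_hezE := co H E Z E
  have c_efxX (i j : Fin 2) := co E F (X i) (X j)
  have c_efzH := co E F Z H
  have c_efzZ := co E F Z Z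
  have c_exyE (i j : Fin 2) := co E (X i) (Y j) E
  have c_fxyF (i j : Fin 2) := co F (X i) (Y j) F
  have c_eyzX (i j : Fin 2) := co E (Y i) Z (X j)
  have c_eyyH := co E (Y 0) (Y 1) H
  have c_eyyZ := co E (Y 0) (Y 1) Z
  have c_fxxH := co F (X 0) (X 1) H
  have c_fxxZ := co F (X 0) (X 1) Z
  have c_xxyX (i j : Fin 2) := co (X 0) (X 1) (Y i) (X j)
  have c_xyyY (i j : Fin 2) := co (X i) (Y 0) (Y 1) (Y j)
  have c_xyzZ (i j : Fin 2) := co (X i) (Y j) Z Z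
  clear co
  simp [br, hswap H E, hswap H F, hswap H (X _), hswap H (Y _), hswap H Z, hswap E F,
    hswap E (X _), hswap E (Y _), hswap E Z, hswap F (X _), hswap F (Y _), hswap F Z,
    hswap (X _) (Y _), hswap (X _) Z, hswap (Y _) Z, hx, hy]
    at c_hefH c_heyX c_hxyZ c_hezE c_efxX c_efzH c_efzZ c_exyE c_fxyF c_eyzX c_eyyH c_eyyZ
      c_fxxH c_fxxZ c_xxyX c_xyyY c_xyzZ
  simp [Fin.forall_fin_two] at h_fx h_xyz
  have key : ∀ i j k, ψ (bV i) (bV j) k = 0 := by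
    intro i j k
    by_cases hk : wt k = wt i + wt j
    · cases i <;> cases j <;> cases k <;> norm_num [wt] at hk
      all_goals try simp only [hswap H E, hswap H F, hswap H (X _), hswap H (Y _), hswap H Z,
        hswap E F, hswap E (Y _), hswap E Z, hswap F (X _), hswap F Z, hswap (X _) (Y _),
        hswap (X _) Z, hswap (Y _) Z, hdiag, neg_eq_zero]
      all_goals clear hwt hψ hswap
      all_goals first
        | (rename_i i j; fin_cases i <;> fin_cases j <;> grind only)
        | grind only
    · exact hwt i j k hk
  refine (Pi.basisFun ℂ _).ext fun i => (Pi.basisFun ℂ _).ext fun j => ?_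
  funext k
  simpa using key i j k

theorem cob_coord_eq_zero {n : ℕ} {ω : Sch n →ₗ[ℂ] Sch n}
    (hω : ∀ i k, wt k ≠ wt i → ω (bV i) k = 0) {i j k : SchIdx n} (h : wt k ≠ wt i + wt j) :
    cob ω (bV i) (bV j) k = 0 := by
  have hbr {i j : SchIdx n} (h : wt k ≠ wt i + wt j) : br (bV i) (ω (bV j)) k = 0 := by
    rw [br_bV_apply_of_wt (v := 0) 0, zero_mul]
    intro l hl
    rw [zero_mul]
    exact hω j l fun hlj => h (by rw [← hl, hlj, add_comm])
  rw [cob_apply, Pi.sub_apply, Pi.add_apply, br_swap (ω _), Pi.neg_apply, hbr h,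
    hbr (by rwa [add_comm]), Sch.map_eq_sum ω, Finset.sum_apply, Finset.sum_eq_zero]
  · simp
  · intro l _
    rw [Pi.smul_apply, smul_eq_mul]
    by_cases hl : wt l = wt i + wt j
    · rw [hω l k (by rwa [hl]), mul_zero]
    · rw [br_bV_bV_apply_of_wt hl, zero_mul]

/-- A weight-preserving cocycle of `sch_2` whose `e`-component at `(x_1, x_2)` vanishes is a
coboundary. -/
theorem exists_eq_cob {φ : Sch 2 →ₗ[ℂ] Sch 2 →ₗ[ℂ] Sch 2} (hφ : φ ∈ adjZ2 2)
    (hwt : ∀ i j k, wt k ≠ wt i + wt j → φ (bV i) (bV j) k = 0)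
    (h_xx : φ (bV (X 0)) (bV (X 1)) E = 0) : ∃ ω : Sch 2 →ₗ[ℂ] Sch 2, φ = cob ω := by
  let p : Fin 2 → Fin 2 → ℂ := fun i j => φ (bV F) (bV (X i)) (Y j)
  let q : Fin 2 → Fin 2 → ℂ := fun i j =>
    if i = j then (φ (bV (X i)) (bV (Y j)) Z - p i j) / 2
    else if i < j then φ (bV (X i)) (bV (Y j)) Z - p i j else 0
  let w : SchIdx 2 → Sch 2 := fun i k => match i, k with
    | H, H => φ (bV H) (bV E) E / 2
    | H, Z => -φ (bV E) (bV F) Z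
    | E, E => φ (bV E) (bV F) H + φ (bV H) (bV E) E / 2
    | Z, H => -φ (bV E) (bV Z) E / 2
    | X i, X j => p i j + q i j
    | Y i, Y j => q i j
    | _, _ => 0
  let ω := Fintype.linearCombination ℂ w
  have hω (i) : ω (bV i) = w i := by simp [ω, Fintype.linearCombination_apply_single]
  have hωwt (i k) (h : wt k ≠ wt i) : ω (bV i) k = 0 := by
    rw [hω]
    cases i <;> cases k <;> first | rfl | exact absurd rfl h
  have hωbr (u) : ω u = ∑ i, u i • w i := rfl
  refine ⟨ω, sub_eq_zero.mp (eq_zero_of_coords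
    (sub_mem hφ (adjB2_le_adjZ2 2 (cob_mem_adjB2 ω))) ?_ ?_ ?_ ?_ ?_ ?_ ?_ ?_)⟩
  · intro i j k h
    simp [-cob_apply, hwt i j k h, cob_coord_eq_zero hωwt h]
  all_goals simp only [LinearMap.sub_apply, cob_apply, hω, hωbr, sum_two, Pi.sub_apply,
    Fin.forall_fin_two]
  all_goals simp [br, w, p, q, h_xx]
  · ring
  · ring
  · constructor <;> ring

/-- A cocycle spanning the second adjoint cohomology of `sch_2`. -/
noncomputable def phi₀ : Sch 2 →ₗ[ℂ] Sch 2 →ₗ[ℂ] Sch 2 :=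
  LinearMap.mk₂ ℂ
    (fun u v j => match j with
      | H => (u (X 1) * v (Y 0) - u (Y 0) * v (X 1)) - (u (X 0) * v (Y 1) - u (Y 1) * v (X 0))
      | E => 2 * (u (X 0) * v (X 1) - u (X 1) * v (X 0))
      | F => -2 * (u (Y 0) * v (Y 1) - u (Y 1) * v (Y 0))
      | X 0 => -3 * (u (X 1) * v Z - u Z * v (X 1))
      | X 1 => 3 * (u (X 0) * v Z - u Z * v (X 0))
      | Y 0 => -3 * (u (Y 1) * v Z - u Z * v (Y 1))
      | Y 1 => 3 * (u (Y 0) * v Z - u Z * v (Y 0))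
      | Z => 0)
    (fun _ _ _ => by funext j; rcases j with _ | _ | _ | i | i | _ <;> try fin_cases i
                     all_goals simp <;> ring)
    (fun _ _ _ => by funext j; rcases j with _ | _ | _ | i | i | _ <;> try fin_cases i
                     all_goals simp <;> ring)
    (fun _ _ _ => by funext j; rcases j with _ | _ | _ | i | i | _ <;> try fin_cases i
                     all_goals simp <;> ring)
    (fun _ _ _ => by funext j; rcases j with _ | _ | _ | i | i | _ <;> try fin_cases i
                     all_goals simp <;> ring)

theorem phi₀_mem_adjZ2 : phi₀ ∈ adjZ2 2 := by
  refine ⟨fun a => ?_, fun a b c => ?_⟩ <;> funext j <;>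
    rcases j with _ | _ | _ | i | i | _ <;> try fin_cases i
  all_goals simp [phi₀, br] <;> ring

theorem adjB2_coord_eq_zero {n : ℕ} {φ : Sch n →ₗ[ℂ] Sch n →ₗ[ℂ] Sch n} (hφ : φ ∈ adjB2 n)
    (i j : Fin n) : φ (bV (X i)) (bV (X j)) E = 0 := by
  obtain ⟨ω, hω⟩ := hφ
  have h : br (bV (X i) : Sch n) (bV (X j)) = 0 := by
    funext k
    cases k <;> simp [br]
  simp only [hω, brL_apply, h]
  simp [br]

/-- **The second adjoint cohomology of the 2nd Schrödinger algebra is one-dimensional: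
`dim H²(sch_2, sch_2) = 1`, where `H²(sch_2,sch_2) = Z²(sch_2,sch_2)/B²(sch_2,sch_2)`.** -/
theorem dim_H2_adjoint_schrodinger_two :
    Module.finrank ℂ
        (↥(adjZ2 2) ⧸ Submodule.comap (adjZ2 2).subtype (adjB2 2)) = 1 := by
  have hcoord : phi₀ (bV (X 0)) (bV (X 1)) E = 2 := by simp [phi₀]
  refine finrank_eq_one_iff'.mpr ⟨Submodule.Quotient.mk ⟨phi₀, phi₀_mem_adjZ2⟩, ?_, ?_⟩
  · rw [Ne, Submodule.Quotient.mk_eq_zero]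
    intro h
    have := adjB2_coord_eq_zero (φ := phi₀) h 0 1
    norm_num [hcoord] at this
  · intro x
    obtain ⟨⟨φ, hφ⟩, rfl⟩ := Submodule.Quotient.mk_surjective _ x
    let c : ℂ := φ (bV (X 0)) (bV (X 1)) E / 2
    have hφ' : φ - c • phi₀ ∈ adjZ2 2 := sub_mem hφ ((adjZ2 2).smul_mem c phi₀_mem_adjZ2)
    obtain ⟨ω₁, h₁⟩ := exists_cob_wt hφ'
    obtain ⟨ω₂, h₂⟩ := exists_eq_cob (φ := φ - c • phi₀ - cob ω₁)
      (sub_mem hφ' (adjB2_le_adjZ2 2 (cob_mem_adjB2 ω₁)))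
      (fun i j k hk => sub_eq_zero.mpr (h₁ i j k hk)) (by
        simp only [LinearMap.sub_apply, LinearMap.smul_apply, Pi.sub_apply, Pi.smul_apply,
          adjB2_coord_eq_zero (cob_mem_adjB2 ω₁), hcoord, smul_eq_mul]
        simp [c])
    refine ⟨c, (sub_eq_zero.mp ?_).symm⟩
    refine (Submodule.Quotient.mk_eq_zero (Submodule.comap (adjZ2 2).subtype (adjB2 2))
      (x := (⟨φ, hφ⟩ - c • ⟨phi₀, phi₀_mem_adjZ2⟩ : adjZ2 2))).mpr ?_
    have h : φ - c • phi₀ = cob ω₂ + cob ω₁ := by rw [← h₂, sub_add_cancel]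
    change φ - c • phi₀ ∈ adjB2 2
    rw [h]
    exact add_mem (cob_mem_adjB2 ω₂) (cob_mem_adjB2 ω₁)
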